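/- arXiv:nlin/0007018 — 2 statements merged into one kernel-verified Lean document; each statement's English description precedes it below -/
import Mathlib

section
/- Let n ∈ ℕ, let f : ℝⁿ × ℝ → ℝⁿ be continuously differentiable, bounded with bounded derivatives, and 2π-periodic in its second argument, and let g : ℝⁿ × ℝ × ℝ → ℝⁿ be continuously differentiable and bounded with bounded derivatives, with g(·,·,ε) 2π-periodic in its second argument. Define ⟨f⟩(y) = (1/2π)∫₀^{2π} f(y,t) dt. Suppose y₀ ∈ ℝⁿ is a nondegenerate equilibrium of the averaged system, i.e. ⟨f⟩(y₀) = 0 and the Jacobian matrix D⟨f⟩(y₀) is invertible. Then there exist ε₀ > 0 and C > 0 such that for every ε ∈ (0, ε₀] the equation ẋ(t) = ε f(x(t), t) + ε² g(x(t), t, ε) possesses a 2π-periodic solution γ_ε : ℝ → ℝⁿ satisfying ‖γ_ε(t) − y₀‖ ≤ C ε for all t ∈ ℝ. -/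
open Real MeasureTheory

section PeriodicFunctions

variable {E : Type*} [NormedAddCommGroup E] [NormedSpace ℝ E]

/-- The mean value of `h` over `[0, T]`. -/
noncomputable def periodMean (T : ℝ) (h : ℝ → E) : E :=
  (1 / T) • ∫ t in (0 : ℝ)..T, h t

/-- The primitive, vanishing at `0`, of `h` minus its mean value over `[0, T]`. -/
noncomputable def zeroMeanPrimitive (T : ℝ) (h : ℝ → E) (t : ℝ) : E :=
  ∫ s in (0 : ℝ)..t, (h s - periodMean T h)

lemma periodMean_sub {T : ℝ} {h k : ℝ → E} (hh : Continuous h) (hk : Continuous k) :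
    periodMean T (fun t => h t - k t) = periodMean T h - periodMean T k := by
  unfold periodMean
  rw [intervalIntegral.integral_sub (hh.intervalIntegrable _ _) (hk.intervalIntegrable _ _),
    smul_sub]

lemma norm_periodMean_le {T N : ℝ} (hT : 0 < T) {h : ℝ → E}
    (hN : ∀ t ∈ Set.Icc 0 T, ‖h t‖ ≤ N) : ‖periodMean T h‖ ≤ N := by
  have h1 : ‖∫ t in (0 : ℝ)..T, h t‖ ≤ N * |T - 0| :=
    intervalIntegral.norm_integral_le_of_norm_le_const fun t ht => by
      rw [Set.uIoc_of_le hT.le] at ht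
      exact hN t ⟨ht.1.le, ht.2⟩
  rw [sub_zero, abs_of_pos hT] at h1
  unfold periodMean
  rw [norm_smul, Real.norm_of_nonneg (by positivity), one_div, inv_mul_le_iff₀ hT]
  linarith

lemma continuous_zeroMeanPrimitive (T : ℝ) {h : ℝ → E} (hh : Continuous h) :
    Continuous (zeroMeanPrimitive T h) :=
  intervalIntegral.continuous_primitive
    (fun _ _ => (hh.sub continuous_const).intervalIntegrable _ _) 0

lemma zeroMeanPrimitive_sub {T : ℝ} {h k : ℝ → E} (hh : Continuous h) (hk : Continuous k)
    (t : ℝ) : zeroMeanPrimitive T (fun s => h s - k s) t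
      = zeroMeanPrimitive T h t - zeroMeanPrimitive T k t := by
  have hh' : Continuous fun s => h s - periodMean T h := hh.sub continuous_const
  have hk' : Continuous fun s => k s - periodMean T k := hk.sub continuous_const
  unfold zeroMeanPrimitive
  rw [← intervalIntegral.integral_sub (hh'.intervalIntegrable _ _)
    (hk'.intervalIntegrable _ _), periodMean_sub hh hk]
  congr 1
  funext s
  exact sub_sub_sub_comm _ _ _ _

variable [CompleteSpace E]

lemma periodic_zeroMeanPrimitive {T : ℝ} (hT : 0 < T) {h : ℝ → E} (hh : Continuous h)
    (hp : Function.Periodic h T) : Function.Periodic (zeroMeanPrimitive T h) T := by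
  intro t
  have hc : Continuous fun s => h s - periodMean T h := hh.sub continuous_const
  have hp' : Function.Periodic (fun s => h s - periodMean T h) T := fun s => by
    simp only [hp s]
  have h0 : ∫ s in (0 : ℝ)..T, (h s - periodMean T h) = 0 := by
    rw [intervalIntegral.integral_sub (hh.intervalIntegrable _ _)
      (continuous_const.intervalIntegrable _ _), intervalIntegral.integral_const, periodMean,
      smul_smul, sub_zero, mul_one_div_cancel hT.ne', one_smul, sub_self]
  unfold zeroMeanPrimitive
  rw [← intervalIntegral.integral_add_adjacent_intervals (hc.intervalIntegrable 0 t)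
    (hc.intervalIntegrable t (t + T)), hp'.intervalIntegral_add_eq t 0, zero_add, h0, add_zero]

lemma norm_zeroMeanPrimitive_le {T N : ℝ} (hT : 0 < T) {h : ℝ → E} (hh : Continuous h)
    (hp : Function.Periodic h T) (hN : ∀ t ∈ Set.Icc 0 T, ‖h t‖ ≤ N) (t : ℝ) :
    ‖zeroMeanPrimitive T h t‖ ≤ 2 * T * N := by
  obtain ⟨s, hs, hst⟩ := (periodic_zeroMeanPrimitive hT hh hp).exists_mem_Ico₀ hT t
  have hN0 : 0 ≤ N := (norm_nonneg _).trans (hN 0 ⟨le_rfl, hT.le⟩)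
  have h1 : ‖zeroMeanPrimitive T h s‖ ≤ (2 * N) * |s - 0| :=
    intervalIntegral.norm_integral_le_of_norm_le_const fun u hu => by
      rw [Set.uIoc_of_le hs.1] at hu
      have h2 := hN u ⟨hu.1.le, hu.2.trans hs.2.le⟩
      have h3 := norm_periodMean_le hT hN
      exact (norm_sub_le _ _).trans (by linarith)
  rw [sub_zero, abs_of_nonneg hs.1] at h1
  rw [hst]
  nlinarith [hs.2, hs.1]

/-- The continuous map on the circle induced by a continuous periodic function. -/
def circleLift {T : ℝ} (h : ℝ → E) (hh : Continuous h) (hp : Function.Periodic h T) :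
    C(AddCircle T, E) where
  toFun := hp.lift
  continuous_toFun :=
    (QuotientAddGroup.isQuotientMap_mk (AddSubgroup.zmultiples T)).continuous_iff.2 hh

end PeriodicFunctions

lemma exists_fixedPoint_mem_closedBall {X : Type*} [MetricSpace X] [CompleteSpace X]
    {Φ : X → X} {z₀ : X} {ρ : ℝ} (hρ : 0 ≤ ρ)
    (hΦ : ∀ z ∈ Metric.closedBall z₀ ρ, ∀ z' ∈ Metric.closedBall z₀ ρ,
      dist (Φ z) (Φ z') ≤ 1 / 2 * dist z z')
    (h₀ : dist (Φ z₀) z₀ ≤ ρ / 2) :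
    ∃ z ∈ Metric.closedBall z₀ ρ, Φ z = z := by
  have hz₀ : z₀ ∈ Metric.closedBall z₀ ρ := Metric.mem_closedBall_self hρ
  have hmaps : Set.MapsTo Φ (Metric.closedBall z₀ ρ) (Metric.closedBall z₀ ρ) := by
    intro z hz
    have h1 := hΦ z hz z₀ hz₀
    have h2 := dist_triangle (Φ z) (Φ z₀) z₀
    rw [Metric.mem_closedBall] at hz ⊢
    linarith
  have hcontr : ContractingWith (1 / 2) (hmaps.restrict Φ _ _) := by
    refine ⟨by rw [← NNReal.coe_lt_coe]; norm_num, LipschitzWith.of_dist_le_mul ?_⟩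
    rintro ⟨z, hz⟩ ⟨z', hz'⟩
    have h := hΦ z hz z' hz'
    rw [Subtype.dist_eq, Subtype.dist_eq]
    simpa using h
  obtain ⟨z, hz, hfix, -⟩ := ContractingWith.exists_fixedPoint'
    Metric.isClosed_closedBall.isComplete hmaps hcontr hz₀ (edist_ne_top _ _)
  exact ⟨z, hz, hfix⟩

/-- Quantitative existence of a `T`-periodic solution of `ẋ = ε V(x, t)` near `y₀`, when `V` is
close to its linearization `B` at `y₀` and the mean of `B` is invertible. -/
lemma exists_periodic_solution_near {E : Type*} [NormedAddCommGroup E] [NormedSpace ℝ E]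
    [CompleteSpace E] {T : ℝ} (hT : 0 < T) {V : E × ℝ → E} (hV : Continuous V)
    (hper : ∀ x t, V (x, t + T) = V (x, t)) {L N b c r η ε μ ρ : ℝ} {y₀ : E}
    (hc : 0 ≤ c) (hL : 0 ≤ L) (hε : 0 < ε) (hμ : 0 < μ) (hμ1 : μ ≤ 1) (hρ : 0 ≤ ρ)
    (hVlip : ∀ x x' t, ‖V (x, t) - V (x', t)‖ ≤ L * ‖x - x'‖)
    (hVbdd : ∀ x t, ‖V (x, t)‖ ≤ N)
    {B : ℝ → E →L[ℝ] E} (hB : Continuous B) (hBb : ∀ t, ‖B t‖ ≤ b)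
    (hBV : ∀ x ∈ Metric.closedBall y₀ r, ∀ x' ∈ Metric.closedBall y₀ r, ∀ t ∈ Set.Icc 0 T,
      ‖V (x, t) - V (x', t) - B t (x - x')‖ ≤ c * ‖x - x'‖)
    (A : E ≃L[ℝ] E) (hA : ∀ v, A v = periodMean T (fun t => B t v))
    (hη : ‖periodMean T (fun t => V (y₀, t))‖ ≤ η)
    (h1 : ‖(A.symm : E →L[ℝ] E)‖ * (2 * c + μ * b) ≤ 1 / 2)
    (h2 : ε / μ * (2 * T * (2 * L)) ≤ 1 / 2)
    (h3 : ‖(A.symm : E →L[ℝ] E)‖ * η ≤ ρ / 2)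
    (h4 : ε / μ * (2 * T * N) ≤ ρ / 2)
    (h5 : 2 * ρ ≤ r) :
    ∃ γ : ℝ → E, (∀ t, HasDerivAt γ (ε • V (γ t, t)) t) ∧ (∀ t, γ (t + T) = γ t) ∧
      ∀ t, ‖γ t - y₀‖ ≤ 2 * ρ := by
  have : Fact (0 < T) := ⟨hT⟩
  set K := ‖(A.symm : E →L[ℝ] E)‖
  have hK0 : 0 ≤ K := norm_nonneg _
  have hb : 0 ≤ b := (norm_nonneg _).trans (hBb 0)
  let curve : E × C(AddCircle T, E) → ℝ → E := fun z t => z.1 + μ • z.2 (t : AddCircle T)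
  have curve_cont : ∀ z, Continuous (curve z) := fun z =>
    continuous_const.add
      ((z.2.continuous.comp (AddCircle.continuous_mk' T)).const_smul μ)
  have curve_per : ∀ z t, curve z (t + T) = curve z t := fun z t => by
    simp [curve]
  let W : E × C(AddCircle T, E) → ℝ → E := fun z t => V (curve z t, t)
  have W_cont : ∀ z, Continuous (W z) := fun z => hV.comp ((curve_cont z).prodMk continuous_id)
  have W_per : ∀ z, Function.Periodic (W z) T := fun z t => by
    simp only [W, curve_per, hper]
  have P_cont : ∀ z, Continuous fun t => (ε / μ) • zeroMeanPrimitive T (W z) t := fun z =>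
    (continuous_zeroMeanPrimitive T (W_cont z)).const_smul _
  have P_per : ∀ z, Function.Periodic (fun t => (ε / μ) • zeroMeanPrimitive T (W z) t) T :=
    fun z t => by simp only [periodic_zeroMeanPrimitive hT (W_cont z) (W_per z) t]
  let Φ : E × C(AddCircle T, E) → E × C(AddCircle T, E) := fun z =>
    (z.1 - A.symm (periodMean T (W z)), circleLift _ (P_cont z) (P_per z))
  have Φ_snd : ∀ z (t : ℝ), (Φ z).2 (t : AddCircle T)
      = (ε / μ) • zeroMeanPrimitive T (W z) t := fun _ _ => rfl
  let z₀ : E × C(AddCircle T, E) := (y₀, 0)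
  have curve_z₀ : ∀ t, curve z₀ t = y₀ := fun t => by simp [curve, z₀]
  have snd_le : ∀ (z z' : E × C(AddCircle T, E)) (t : ℝ),
      ‖z.2 (t : AddCircle T) - z'.2 (t : AddCircle T)‖ ≤ dist z z' := fun z z' t => by
    rw [← dist_eq_norm]
    exact (ContinuousMap.dist_apply_le_dist _).trans (le_max_right _ _)
  have fst_le : ∀ (z z' : E × C(AddCircle T, E)), ‖z.1 - z'.1‖ ≤ dist z z' := fun z z' => by
    rw [← dist_eq_norm]
    exact le_max_left _ _
  have curve_sub : ∀ z z' t, curve z t - curve z' t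
      = (z.1 - z'.1) + μ • (z.2 (t : AddCircle T) - z'.2 (t : AddCircle T)) := fun z z' t => by
    simp only [curve, smul_sub]
    abel
  have curve_le : ∀ z z' t, ‖curve z t - curve z' t‖ ≤ 2 * dist z z' := fun z z' t => by
    rw [curve_sub]
    refine (norm_add_le _ _).trans ?_
    rw [norm_smul, Real.norm_of_nonneg hμ.le]
    have := mul_le_mul hμ1 (snd_le z z' t) (norm_nonneg _) zero_le_one
    linarith [fst_le z z']
  have curve_near : ∀ z ∈ Metric.closedBall z₀ ρ, ∀ t, ‖curve z t - y₀‖ ≤ 2 * ρ := by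
    intro z hz t
    have := curve_le z z₀ t
    rw [curve_z₀] at this
    rw [Metric.mem_closedBall] at hz
    linarith
  have dist_le : ∀ (z z' : E × C(AddCircle T, E)) (d : ℝ), ‖z.1 - z'.1‖ ≤ d →
      (∀ t : ℝ, ‖z.2 (t : AddCircle T) - z'.2 (t : AddCircle T)‖ ≤ d) → dist z z' ≤ d := by
    intro z z' d hd1 hd2
    refine max_le (by rwa [dist_eq_norm])
      ((ContinuousMap.dist_le ((norm_nonneg _).trans hd1)).2 fun x => ?_)
    obtain ⟨t, rfl⟩ := QuotientAddGroup.mk_surjective x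
    rw [dist_eq_norm]
    exact hd2 t
  have hcontr : ∀ z ∈ Metric.closedBall z₀ ρ, ∀ z' ∈ Metric.closedBall z₀ ρ,
      dist (Φ z) (Φ z') ≤ 1 / 2 * dist z z' := by
    intro z hz z' hz'
    have hd : 0 ≤ dist z z' := dist_nonneg
    refine dist_le _ _ _ ?_ fun t => ?_
    · have hBc : Continuous fun t => B t (z.1 - z'.1) := hB.clm_apply continuous_const
      have e : (Φ z).1 - (Φ z').1 = A.symm (periodMean T
          (fun t => B t (z.1 - z'.1) - (W z t - W z' t))) := by
        rw [periodMean_sub (k := fun t => W z t - W z' t) hBc ((W_cont z).sub (W_cont z')),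
          periodMean_sub (W_cont z) (W_cont z'), ← hA]
        simp only [Φ, map_sub, ContinuousLinearEquiv.symm_apply_apply]
        abel
      rw [e]
      have hmean : ‖periodMean T (fun t => B t (z.1 - z'.1) - (W z t - W z' t))‖
          ≤ (2 * c + μ * b) * dist z z' := by
        refine norm_periodMean_le hT fun t ht => ?_
        have e2 : B t (z.1 - z'.1) - (W z t - W z' t)
            = -(V (curve z t, t) - V (curve z' t, t) - B t (curve z t - curve z' t))
              - μ • B t (z.2 (t : AddCircle T) - z'.2 (t : AddCircle T)) := by
          rw [curve_sub, map_add, map_smul]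
          simp only [W]
          abel
        rw [e2]
        refine (norm_sub_le _ _).trans ?_
        rw [norm_neg, norm_smul, Real.norm_of_nonneg hμ.le]
        have q1 := hBV (curve z t)
          (mem_closedBall_iff_norm.2 ((curve_near z hz t).trans h5)) (curve z' t)
          (mem_closedBall_iff_norm.2 ((curve_near z' hz' t).trans h5)) t ht
        have q2 := mul_le_mul_of_nonneg_left (curve_le z z' t) hc
        have q3 : ‖B t (z.2 (t : AddCircle T) - z'.2 (t : AddCircle T))‖ ≤ b * dist z z' :=
          ((B t).le_opNorm _).trans (mul_le_mul (hBb t) (snd_le z z' t) (norm_nonneg _) hb)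
        have q4 := mul_le_mul_of_nonneg_left q3 hμ.le
        linarith
      calc _ ≤ K * ‖periodMean T (fun t => B t (z.1 - z'.1) - (W z t - W z' t))‖ :=
            (A.symm : E →L[ℝ] E).le_opNorm _
        _ ≤ K * ((2 * c + μ * b) * dist z z') := mul_le_mul_of_nonneg_left hmean hK0
        _ = K * (2 * c + μ * b) * dist z z' := by ring
        _ ≤ 1 / 2 * dist z z' := mul_le_mul_of_nonneg_right h1 hd
    · rw [Φ_snd, Φ_snd, ← smul_sub, ← zeroMeanPrimitive_sub (W_cont z) (W_cont z'), norm_smul,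
        Real.norm_of_nonneg (by positivity)]
      have q : ‖zeroMeanPrimitive T (fun s => W z s - W z' s) t‖
          ≤ 2 * T * (L * (2 * dist z z')) := by
        refine norm_zeroMeanPrimitive_le hT ((W_cont z).sub (W_cont z'))
          ((W_per z).sub (W_per z')) (fun s _ => ?_) t
        exact (hVlip _ _ _).trans (mul_le_mul_of_nonneg_left (curve_le z z' s) hL)
      calc _ ≤ ε / μ * (2 * T * (L * (2 * dist z z'))) :=
            mul_le_mul_of_nonneg_left q (by positivity)
        _ = ε / μ * (2 * T * (2 * L)) * dist z z' := by ring
        _ ≤ 1 / 2 * dist z z' := mul_le_mul_of_nonneg_right h2 hd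
  have hinit : dist (Φ z₀) z₀ ≤ ρ / 2 := by
    refine dist_le _ _ _ ?_ fun t => ?_
    · have e : (Φ z₀).1 - z₀.1 = -A.symm (periodMean T (fun t => V (y₀, t))) := by
        have eW : W z₀ = fun t => V (y₀, t) := funext fun t => by simp only [W, curve_z₀]
        simp only [Φ, eW, z₀]
        abel
      rw [e, norm_neg]
      exact ((A.symm : E →L[ℝ] E).le_opNorm _).trans
        ((mul_le_mul_of_nonneg_left hη hK0).trans h3)
    · have e : z₀.2 (t : AddCircle T) = 0 := rfl
      rw [Φ_snd, e, sub_zero, norm_smul, Real.norm_of_nonneg (by positivity)]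
      exact (mul_le_mul_of_nonneg_left (norm_zeroMeanPrimitive_le hT (W_cont z₀) (W_per z₀)
        (fun s _ => hVbdd _ _) t) (by positivity)).trans h4
  obtain ⟨z, hz, hfix⟩ := exists_fixedPoint_mem_closedBall hρ hcontr hinit
  have hmean : periodMean T (W z) = 0 := by
    have := congrArg Prod.fst hfix
    simpa [Φ] using this
  have hcurve : curve z = fun t => z.1 + ε • ∫ s in (0 : ℝ)..t, W z s := by
    funext t
    have e : z.2 (t : AddCircle T) = (ε / μ) • zeroMeanPrimitive T (W z) t := by
      rw [← Φ_snd, hfix]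
    simp only [curve]
    rw [e, smul_smul, mul_div_cancel₀ _ hμ.ne', zeroMeanPrimitive, hmean]
    simp only [sub_zero]
  refine ⟨curve z, fun t => ?_, curve_per z, curve_near z hz⟩
  have hd := (((W_cont z).integral_hasStrictDerivAt 0 t).hasDerivAt.const_smul ε).const_add z.1
  exact hd.congr_of_eventuallyEq (Filter.Eventually.of_forall fun u => congrFun hcurve u)

section PartialDerivative

variable {E F : Type*} [NormedAddCommGroup E] [NormedSpace ℝ E] [NormedAddCommGroup F]
  [NormedSpace ℝ F]

lemma norm_image_sub_le_of_norm_fderiv_le {G : Type*} [NormedAddCommGroup G] [NormedSpace ℝ G]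
    {f : E → G} {M : ℝ} (hf : Differentiable ℝ f) (hM : ∀ q, ‖fderiv ℝ f q‖ ≤ M) (p q : E) :
    ‖f p - f q‖ ≤ M * ‖p - q‖ :=
  convex_univ.norm_image_sub_le_of_norm_fderiv_le (𝕜 := ℝ) (fun x _ => hf x) (fun x _ => hM x)
    (Set.mem_univ q) (Set.mem_univ p)

lemma hasFDerivAt_comp_prodMk_left {f : E × ℝ → F} (hf : Differentiable ℝ f) (x : E) (t : ℝ) :
    HasFDerivAt (fun y => f (y, t))
      ((fderiv ℝ f (x, t)).comp (ContinuousLinearMap.inl ℝ E ℝ)) x :=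
  (hf (x, t)).hasFDerivAt.comp x (hasFDerivAt_prodMk_left x t)

lemma norm_comp_inl_le (φ : E × ℝ →L[ℝ] F) :
    ‖φ.comp (ContinuousLinearMap.inl ℝ E ℝ)‖ ≤ ‖φ‖ :=
  ContinuousLinearMap.opNorm_le_bound _ (norm_nonneg _) fun v => by
    simpa using φ.le_opNorm (v, 0)

/-- Strict differentiability in `x` of a `C¹` function `f (x, t)`, uniformly for `t` in a
compact set. -/
lemma exists_closedBall_norm_sub_sub_le {f : E × ℝ → F} (hf : ContDiff ℝ 1 f) (y₀ : E)
    {S : Set ℝ} (hS : IsCompact S) {c : ℝ} (hc : 0 < c) :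
    ∃ r > 0, ∀ x ∈ Metric.closedBall y₀ r, ∀ x' ∈ Metric.closedBall y₀ r, ∀ t ∈ S,
      ‖f (x, t) - f (x', t)
        - (fderiv ℝ f (y₀, t)).comp (ContinuousLinearMap.inl ℝ E ℝ) (x - x')‖
        ≤ c * ‖x - x'‖ := by
  have hcont : Continuous (fderiv ℝ f) := hf.continuous_fderiv one_ne_zero
  have hev : ∀ᶠ x in nhds y₀, ∀ t ∈ S, ‖fderiv ℝ f (x, t) - fderiv ℝ f (y₀, t)‖ < c := by
    refine hS.eventually_forall_of_forall_eventually fun t _ => ?_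
    have hg : Continuous fun z : E × ℝ =>
        ‖fderiv ℝ f (z.1, z.2) - fderiv ℝ f (y₀, z.2)‖ := by fun_prop
    refine hg.continuousAt.eventually_lt_const ?_
    simpa using hc
  obtain ⟨r, hr, hball⟩ := Metric.nhds_basis_closedBall.eventually_iff.1 hev
  refine ⟨r, hr, fun x hx x' hx' t ht => ?_⟩
  refine (convex_closedBall y₀ r).norm_image_sub_le_of_norm_hasFDerivWithin_le'
    (f := fun y => f (y, t)) (fun y _ =>
      (hasFDerivAt_comp_prodMk_left (hf.differentiable one_ne_zero) y t).hasFDerivWithinAt)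
    (fun y hy => ?_) hx' hx
  rw [← ContinuousLinearMap.sub_comp]
  exact (norm_comp_inl_le _).trans (hball hy t ht).le

/-- Differentiation under the mean. -/
lemma hasFDerivAt_periodMean [CompleteSpace F] {f : E × ℝ → F} (hf : ContDiff ℝ 1 f) {M : ℝ}
    (hM : ∀ q, ‖fderiv ℝ f q‖ ≤ M) (T : ℝ) (y₀ : E) :
    HasFDerivAt (fun y => periodMean T (fun t => f (y, t)))
      (periodMean T fun t => (fderiv ℝ f (y₀, t)).comp (ContinuousLinearMap.inl ℝ E ℝ)) y₀ := by
  have hcont : Continuous (fderiv ℝ f) := hf.continuous_fderiv one_ne_zero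
  have hfc : Continuous f := hf.continuous
  refine HasFDerivAt.const_smul ?_ (1 / T)
  refine intervalIntegral.hasFDerivAt_integral_of_dominated_of_fderiv_le
    (s := Set.univ) (bound := fun _ => M)
    (F' := fun y t => (fderiv ℝ f (y, t)).comp (ContinuousLinearMap.inl ℝ E ℝ))
    Filter.univ_mem (Filter.Eventually.of_forall fun y => ?_) ?_ ?_
    (Filter.Eventually.of_forall fun t _ y _ => (norm_comp_inl_le _).trans (hM _))
    (continuous_const.intervalIntegrable _ _)
    (Filter.Eventually.of_forall fun t _ y _ =>
      hasFDerivAt_comp_prodMk_left (hf.differentiable one_ne_zero) y t)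
  · exact Continuous.aestronglyMeasurable (by fun_prop)
  · exact Continuous.intervalIntegrable (by fun_prop) _ _
  · exact Continuous.aestronglyMeasurable (by fun_prop)

end PartialDerivative

/-- Averaging theorem, part (ii): to a nondegenerate equilibrium `y₀` of the averaged
system `ẏ = ε ⟨f⟩(y)` there corresponds, for each small `ε > 0`, a `2π`-periodic solution
of the full system `ẋ = ε f(x,t) + ε² g(x,t,ε)` lying within distance `O(ε)` of `y₀`. -/
theorem averaging_periodic_orbit
    (n : ℕ)
    (f : EuclideanSpace ℝ (Fin n) × ℝ → EuclideanSpace ℝ (Fin n))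
    (g : EuclideanSpace ℝ (Fin n) × ℝ × ℝ → EuclideanSpace ℝ (Fin n))
    (hf_smooth : ContDiff ℝ 1 f)
    (hf_bdd : ∃ M : ℝ, ∀ q, ‖f q‖ ≤ M ∧ ‖fderiv ℝ f q‖ ≤ M)
    (hf_per : ∀ x t, f (x, t + 2 * π) = f (x, t))
    (hg_smooth : ContDiff ℝ 1 g)
    (hg_bdd : ∃ M : ℝ, ∀ q, ‖g q‖ ≤ M ∧ ‖fderiv ℝ g q‖ ≤ M)
    (hg_per : ∀ x t ε, g (x, t + 2 * π, ε) = g (x, t, ε))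
    (favg : EuclideanSpace ℝ (Fin n) → EuclideanSpace ℝ (Fin n))
    (hfavg : ∀ y, favg y = (1 / (2 * π)) • ∫ t in (0:ℝ)..(2 * π), f (y, t))
    (y₀ : EuclideanSpace ℝ (Fin n))
    (heq : favg y₀ = 0)
    (hnondeg : Function.Bijective (fderiv ℝ favg y₀)) :
    ∃ ε₀ : ℝ, 0 < ε₀ ∧ ∃ C : ℝ, 0 < C ∧
      ∀ ε : ℝ, 0 < ε → ε ≤ ε₀ →
        ∃ γ : ℝ → EuclideanSpace ℝ (Fin n),
          (∀ t, HasDerivAt γ (ε • f (γ t, t) + ε ^ 2 • g (γ t, t, ε)) t) ∧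
          (∀ t, γ (t + 2 * π) = γ t) ∧
          (∀ t, ‖γ t - y₀‖ ≤ C * ε) := by
  obtain ⟨M₁, hM₁⟩ := hf_bdd
  obtain ⟨M₂, hM₂⟩ := hg_bdd
  obtain ⟨M, hM, hM1, hM2⟩ : ∃ M : ℝ, 0 < M ∧ M₁ ≤ M ∧ M₂ ≤ M :=
    ⟨max (max M₁ M₂) 1, by positivity, by simp, by simp⟩
  have hfM : ∀ q, ‖f q‖ ≤ M := fun q => (hM₁ q).1.trans hM1
  have hf'M : ∀ q, ‖fderiv ℝ f q‖ ≤ M := fun q => (hM₁ q).2.trans hM1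
  have hgM : ∀ q, ‖g q‖ ≤ M := fun q => (hM₂ q).1.trans hM2
  have hg'M : ∀ q, ‖fderiv ℝ g q‖ ≤ M := fun q => (hM₂ q).2.trans hM2
  have hfc : Continuous f := hf_smooth.continuous
  have hgc : Continuous g := hg_smooth.continuous
  have hf'c : Continuous (fderiv ℝ f) := hf_smooth.continuous_fderiv one_ne_zero
  have hT : 0 < 2 * π := by positivity
  set B : ℝ → EuclideanSpace ℝ (Fin n) →L[ℝ] EuclideanSpace ℝ (Fin n) := fun t =>
    (fderiv ℝ f (y₀, t)).comp (ContinuousLinearMap.inl ℝ _ ℝ)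
  have hB : Continuous B := by fun_prop
  have hBM : ∀ t, ‖B t‖ ≤ M := fun t => (norm_comp_inl_le _).trans (hf'M _)
  have hfavg' : favg = fun y => periodMean (2 * π) (fun t => f (y, t)) := funext hfavg
  have hderiv : fderiv ℝ favg y₀ = periodMean (2 * π) B := by
    rw [hfavg']
    exact (hasFDerivAt_periodMean hf_smooth hf'M (2 * π) y₀).fderiv
  let A : EuclideanSpace ℝ (Fin n) ≃L[ℝ] EuclideanSpace ℝ (Fin n) :=
    (LinearEquiv.ofBijective (fderiv ℝ favg y₀).toLinearMap hnondeg).toContinuousLinearEquiv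
  have hA : ∀ v, A v = periodMean (2 * π) (fun t => B t v) := fun v => by
    have e : A v = fderiv ℝ favg y₀ v := rfl
    rw [e, hderiv]
    simp only [periodMean, smul_apply]
    rw [ContinuousLinearMap.intervalIntegral_apply (hB.intervalIntegrable _ _)]
  set K := ‖(A.symm : EuclideanSpace ℝ (Fin n) →L[ℝ] EuclideanSpace ℝ (Fin n))‖
  have hK0 : 0 ≤ K := norm_nonneg _
  set c : ℝ := 1 / (12 * (K + 1)) with hc
  have hc0 : 0 < c := by positivity
  obtain ⟨r, hr, hball⟩ :=
    exists_closedBall_norm_sub_sub_le hf_smooth y₀ (isCompact_Icc (a := 0) (b := 2 * π)) hc0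
  obtain ⟨μ, hμ, hμ1, hμK⟩ : ∃ μ : ℝ, 0 < μ ∧ μ ≤ 1 ∧ (K + 1) * (μ * M) ≤ 1 / 6 := by
    refine ⟨min 1 (1 / (6 * (K + 1) * M)), by positivity, min_le_left _ _, ?_⟩
    calc _ ≤ (K + 1) * (1 / (6 * (K + 1) * M) * M) := by gcongr; exact min_le_right _ _
      _ = 1 / 6 := by field_simp
  set D : ℝ := K * M + 1 / μ * (2 * (2 * π) * (2 * M)) with hD
  have hD0 : 0 < D := by positivity
  refine ⟨min (min 1 (1 / (12 * (K + 1) * M)))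
    (min (1 / (2 * (1 / μ * (2 * (2 * π) * (2 * (2 * M)))))) (r / (4 * D))), by positivity,
    4 * D, by positivity, fun ε hε hε₀ => ?_⟩
  simp only [le_min_iff] at hε₀
  obtain ⟨⟨hε1, hεK⟩, hεμ, hεr⟩ := hε₀
  rw [le_div_iff₀ (by positivity)] at hεK hεμ hεr
  have hcK : (K + 1) * c = 1 / 12 := by rw [hc]; field_simp
  have hVlip : ∀ x x' t, ‖g (x, t, ε) - g (x', t, ε)‖ ≤ M * ‖x - x'‖ := fun x x' t => by
    simpa using norm_image_sub_le_of_norm_fderiv_le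
      (hg_smooth.differentiable one_ne_zero) hg'M (x, t, ε) (x', t, ε)
  have hflip : ∀ x x' t, ‖f (x, t) - f (x', t)‖ ≤ M * ‖x - x'‖ := fun x x' t => by
    simpa using norm_image_sub_le_of_norm_fderiv_le
      (hf_smooth.differentiable one_ne_zero) hf'M (x, t) (x', t)
  have hεg : ∀ x t, ‖ε • g (x, t, ε)‖ ≤ ε * M := fun x t => by
    rw [norm_smul, Real.norm_of_nonneg hε.le]
    exact mul_le_mul_of_nonneg_left (hgM _) hε.le
  have hεglip : ∀ x x' t, ‖ε • g (x, t, ε) - ε • g (x', t, ε)‖ ≤ ε * M * ‖x - x'‖ :=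
    fun x x' t => by
      rw [← smul_sub, norm_smul, Real.norm_of_nonneg hε.le, mul_assoc]
      exact mul_le_mul_of_nonneg_left (hVlip x x' t) hε.le
  have hεM : ε * M ≤ M := mul_le_of_le_one_left hM.le hε1
  obtain ⟨γ, hγ, hγper, hγnear⟩ := exists_periodic_solution_near (T := 2 * π) hT
    (V := fun p => f p + ε • g (p.1, p.2, ε)) (by fun_prop)
    (fun x t => by simp only [hf_per, hg_per]) (L := 2 * M) (N := 2 * M) (b := M)
    (c := c + ε * M) (r := r) (η := ε * M) (ε := ε) (μ := μ) (ρ := 2 * D * ε) (y₀ := y₀)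
    (by positivity) (by positivity) hε hμ hμ1 (by positivity)
    (fun x x' t => by
      have h1 := hflip x x' t
      have h2 := hεglip x x' t
      have h3 := mul_le_mul_of_nonneg_right hεM (norm_nonneg (x - x'))
      rw [add_sub_add_comm]
      exact (norm_add_le _ _).trans (by linarith))
    (fun x t => (norm_add_le _ _).trans (by linarith [hfM (x, t), hεg x t]))
    hB hBM
    (fun x hx x' hx' t ht => by
      have h1 := hball x hx x' hx' t ht
      have h2 := hεglip x x' t
      rw [add_sub_add_comm, add_sub_right_comm]
      exact (norm_add_le _ _).trans (by linarith))
    A hA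
    (by
      have h0 : periodMean (2 * π) (fun t => f (y₀, t)) = 0 := by
        rw [← heq, hfavg']
      have e : periodMean (2 * π) (fun t => f (y₀, t) + ε • g (y₀, t, ε))
          = periodMean (2 * π) (fun t => f (y₀, t) + ε • g (y₀, t, ε) - f (y₀, t)) := by
        rw [periodMean_sub (by fun_prop) (by fun_prop), h0, sub_zero]
      rw [e]
      refine norm_periodMean_le hT fun t _ => ?_
      rw [add_sub_cancel_left]
      exact hεg y₀ t)
    (by
      calc K * (2 * (c + ε * M) + μ * M) ≤ (K + 1) * (2 * (c + ε * M) + μ * M) := by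
            gcongr; linarith
        _ ≤ 1 / 2 := by linarith)
    (by
      have e : ε / μ * (2 * (2 * π) * (2 * (2 * M)))
          = ε * (2 * (1 / μ * (2 * (2 * π) * (2 * (2 * M))))) / 2 := by ring
      rw [e]
      linarith)
    (by
      have : 0 ≤ ε * (1 / μ * (2 * (2 * π) * (2 * M))) := by positivity
      rw [hD]
      linarith)
    (by
      have e : ε / μ * (2 * (2 * π) * (2 * M)) = ε * (1 / μ * (2 * (2 * π) * (2 * M))) := by ring
      have : 0 ≤ ε * (K * M) := by positivity
      rw [e, hD]
      linarith)
    (by linarith)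
  refine ⟨γ, fun t => ?_, hγper, fun t => (hγnear t).trans (by linarith)⟩
  have := hγ t
  rwa [smul_add, smul_smul, ← pow_two] at this
end

section
/- Let Λ > 0, J_e ∈ ℝ, and K ≠ 0 with |J_e| + |K| < Λ. Set a₁ = Λ(Λ − J_e), b₁ = Λ√((Λ − J_e)² − K²), a₂ = Λ(Λ + J_e), b₂ = Λ√((Λ + J_e)² − K²) (so a_j > b_j > 0 and a_j² − b_j² = K²Λ²), and for j = 1,2 define ρ_j(θ) = (KΛ/2)∫₀^θ dθ′/(a_j − b_j cos θ′). Given ψ, χ, w_K ∈ ℝ, set ξ = √(a₁ − b₁ cos ψ), η = √(a₂ − b₂ cos χ), P_ξ = b₁ sin ψ/(Λξ), P_η = b₂ sin χ/(Λη), φ = w_K + ρ₁(ψ) + ρ₂(χ), and w_e = (χ − ψ)/2. Then (1/2)(η P_ξ − ξ P_η) sin φ − (K/(2ξη))(ξ² − η²) cos φ = Y₁ cos w_e cos w_K + Y₂ sin w_e sin w_K, where Y₁ = (K/2)[√((a₂−b₂)/(a₁−b₁)) − √((a₁−b₁)/(a₂−b₂))] and Y₂ = −(|K|/2)[√((a₂+b₂)/(a₁−b₁))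 − √((a₁−b₁)/(a₂+b₂))]. -/
open Real

/-- If `α² = a - b`, `β² = a + b`, then the angle `(αβ/2) ∫₀^θ dt/(a - b cos t)` is the polar angle
of the point `(α cos (θ/2), β sin (θ/2))`, whose modulus is `√(a - b cos θ)`. -/
theorem sqrt_mul_cos_and_sin_integral_inv_sub_cos {a b α β : ℝ} (hα : 0 < α) (hα2 : α ^ 2 = a - b)
    (hβ2 : β ^ 2 = a + b) (hD : ∀ t, 0 < a - b * cos t) (θ : ℝ) :
    √(a - b * cos θ) * cos (α * β / 2 * ∫ t in (0 : ℝ)..θ, 1 / (a - b * cos t))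
        = α * cos (θ / 2) ∧
      √(a - b * cos θ) * sin (α * β / 2 * ∫ t in (0 : ℝ)..θ, 1 / (a - b * cos t))
        = β * sin (θ / 2) := by
  set ρ : ℝ → ℝ := fun θ ↦ α * β / 2 * ∫ t in (0 : ℝ)..θ, 1 / (a - b * cos t) with hρ
  set R : ℝ → ℝ := fun θ ↦ √(a - b * cos θ) with hR
  have hRpos (x) : 0 < R x := sqrt_pos.2 (hD x)
  have hRsq (x) : R x ^ 2 = a - b * cos x := sq_sqrt (hD x).le
  have hcont : Continuous fun t ↦ 1 / (a - b * cos t) :=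
    continuous_const.div (by fun_prop) fun t ↦ (hD t).ne'
  have hρd (x) : HasDerivAt ρ (α * β / 2 * (1 / R x ^ 2)) x := by
    rw [hRsq]
    exact (hcont.integral_hasStrictDerivAt 0 x).hasDerivAt.const_mul _
  have hRd (x) : HasDerivAt R (b * sin x / (2 * R x)) x := by
    have h := ((hasDerivAt_cos x).const_mul b).const_sub a
    convert h.sqrt (hD x).ne' using 1
    simp [hR]
  have hhalf (x : ℝ) : HasDerivAt (fun y : ℝ ↦ y / 2) (1 / 2) x := (hasDerivAt_id x).div_const 2
  have hC (x) : HasDerivAt (fun y ↦ α * cos (y / 2)) (α * (-sin (x / 2) * (1 / 2))) x :=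
    (hhalf x).cos.const_mul α
  have hS (x) : HasDerivAt (fun y ↦ β * sin (y / 2)) (β * (cos (x / 2) * (1 / 2))) x :=
    (hhalf x).sin.const_mul β
  have hpyth (x : ℝ) : sin (x / 2) ^ 2 + cos (x / 2) ^ 2 = 1 := sin_sq_add_cos_sq _
  have hsin (x : ℝ) : sin x = 2 * sin (x / 2) * cos (x / 2) := by
    rw [← sin_two_mul]; ring_nf
  have hcos (x : ℝ) : cos x = cos (x / 2) ^ 2 - sin (x / 2) ^ 2 := by
    rw [← cos_two_mul']; ring_nf
  have hR2 (x) : R x ^ 2 = α ^ 2 * cos (x / 2) ^ 2 + β ^ 2 * sin (x / 2) ^ 2 := by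
    rw [hRsq, hcos, hα2, hβ2]; linear_combination -a * hpyth x
  have hbs (x) : b * sin x = (β ^ 2 - α ^ 2) * sin (x / 2) * cos (x / 2) := by
    rw [hsin, hα2, hβ2]; ring
  have hF (x) : HasDerivAt
      (fun y ↦ (α * cos (y / 2) * cos (ρ y) + β * sin (y / 2) * sin (ρ y)) / R y) 0 x := by
    refine ((((hC x).mul (hρd x).cos).add ((hS x).mul (hρd x).sin)).div
      (hRd x) (hRpos x).ne').congr_deriv ?_
    have := (hRpos x).ne'
    rw [hbs]
    simp only [Pi.add_apply, Pi.mul_apply]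
    field_simp
    rw [hR2]
    linear_combination (α ^ 2 * β * cos (x / 2) * sin (ρ x) - α * β ^ 2 * sin (x / 2) * cos (ρ x)) *
      hpyth x
  have hG (x) : HasDerivAt
      (fun y ↦ (β * sin (y / 2) * cos (ρ y) - α * cos (y / 2) * sin (ρ y)) / R y) 0 x := by
    refine ((((hS x).mul (hρd x).cos).sub ((hC x).mul (hρd x).sin)).div
      (hRd x) (hRpos x).ne').congr_deriv ?_
    have := (hRpos x).ne'
    rw [hbs]
    simp only [Pi.sub_apply, Pi.mul_apply]
    field_simp
    rw [hR2]
    linear_combination (α ^ 2 * β * cos (x / 2) * cos (ρ x) + α * β ^ 2 * sin (x / 2) * sin (ρ x)) *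
      hpyth x
  have hρ0 : ρ 0 = 0 := by simp [hρ]
  have hR0 : R 0 = α := by simp [hR, ← hα2, hα.le]
  have hF1 := is_const_of_deriv_eq_zero (fun x ↦ (hF x).differentiableAt) (fun x ↦ (hF x).deriv) θ 0
  have hG0 := is_const_of_deriv_eq_zero (fun x ↦ (hG x).differentiableAt) (fun x ↦ (hG x).deriv) θ 0
  simp only [hρ0, hR0, zero_div, cos_zero, sin_zero, mul_zero, mul_one, add_zero, sub_zero,
    div_self hα.ne', div_eq_iff (hRpos θ).ne', one_mul, zero_mul] at hF1 hG0
  have h1 := sin_sq_add_cos_sq (ρ θ)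
  constructor
  · linear_combination (-cos (ρ θ)) * hF1 + sin (ρ θ) * hG0 + α * cos (θ / 2) * h1
  · linear_combination (-sin (ρ θ)) * hF1 - cos (ρ θ) * hG0 + β * sin (θ / 2) * h1

/-- The `cos w_K` and `sin w_K` components of the angular momentum identity, cleared of
denominators, in terms of the polar points `(α c₁, β s₁)` and `(γ c₂, δ s₂)`. -/
theorem lx_polar_polynomial_identities
    {α γ t c₁ s₁ c₂ s₂ : ℝ} (h₁ : s₁ ^ 2 + c₁ ^ 2 = 1) (h₂ : s₂ ^ 2 + c₂ ^ 2 = 1)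
    {β δ X E C S : ℝ} (hβ : β = t * γ) (hδ : δ = t * α)
    (hX : X = α ^ 2 * c₁ ^ 2 + β ^ 2 * s₁ ^ 2) (hE : E = γ ^ 2 * c₂ ^ 2 + δ ^ 2 * s₂ ^ 2)
    (hC : C = α * c₁ * (γ * c₂) - β * s₁ * (δ * s₂))
    (hS : S = β * s₁ * (γ * c₂) + α * c₁ * (δ * s₂)) :
    (E * ((β ^ 2 - α ^ 2) * s₁ * c₁) - X * ((δ ^ 2 - γ ^ 2) * s₂ * c₂)) * S
        - α * γ * t * (X - E) * C = t * (γ ^ 2 - α ^ 2) * (c₂ * c₁ + s₂ * s₁) * (X * E) ∧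
    (E * ((β ^ 2 - α ^ 2) * s₁ * c₁) - X * ((δ ^ 2 - γ ^ 2) * s₂ * c₂)) * C
        + α * γ * t * (X - E) * S = α * γ * (1 - t ^ 2) * (s₂ * c₁ - c₂ * s₁) * (X * E) := by
  subst hC hS hX hE hβ hδ
  constructor
  · linear_combination (α * γ * t * ((α ^ 2 * c₁ ^ 2 + (t * γ) ^ 2 * s₁ ^ 2) * h₂ -
      (γ ^ 2 * c₂ ^ 2 + (t * α) ^ 2 * s₂ ^ 2) * h₁)) *
      (α * c₁ * (γ * c₂) - t * γ * s₁ * (t * α * s₂))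
  · linear_combination -(α * γ * t * ((α ^ 2 * c₁ ^ 2 + (t * γ) ^ 2 * s₁ ^ 2) * h₂ -
      (γ ^ 2 * c₂ ^ 2 + (t * α) ^ 2 * s₂ ^ 2) * h₁)) *
      (t * γ * s₁ * (γ * c₂) + α * c₁ * (t * α * s₂))

/-- If `b = Λ √(u² - K²)` and `a = Λ u` with `|K| < u`, then `0 < b < a` and
`a² - b² = K² Λ²`. -/
theorem pos_lt_and_sq_sub_sq_of_abs_lt {Λ K u : ℝ} (hΛ : 0 < Λ) (hK : K ≠ 0) (hu : |K| < u) :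
    0 < Λ * √(u ^ 2 - K ^ 2) ∧ Λ * √(u ^ 2 - K ^ 2) < Λ * u ∧
      (Λ * u) ^ 2 - (Λ * √(u ^ 2 - K ^ 2)) ^ 2 = K ^ 2 * Λ ^ 2 := by
  have hu0 : 0 < u := (abs_nonneg K).trans_lt hu
  have hK2 : 0 < K ^ 2 := by positivity
  have hpos : 0 < u ^ 2 - K ^ 2 := sub_pos.2 (sq_lt_sq.2 (by rwa [abs_of_pos hu0]))
  refine ⟨by positivity, ?_, ?_⟩
  · exact mul_lt_mul_of_pos_left ((sqrt_lt' hu0).2 (by linarith)) hΛ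
  · rw [mul_pow, mul_pow, sq_sqrt hpos.le]; ring

/-- An ellipse-type denominator `a - b cos t` is positive for `0 < b < a`. -/
theorem sub_mul_cos_pos {a b : ℝ} (hb : 0 < b) (hab : b < a) (t : ℝ) : 0 < a - b * cos t := by
  nlinarith [cos_le_one t]

/-- The x-component of the angular momentum in electric action–angle variables:
with the parabolic parametrization `ξ = √(a₁ − b₁ cos ψ)`, `η = √(a₂ − b₂ cos χ)`,
`P_ξ = b₁ sin ψ/(Λξ)`, `P_η = b₂ sin χ/(Λη)`, `φ = w_K + ρ₁(ψ) + ρ₂(χ)`,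
`w_e = (χ − ψ)/2`, one has `a_j > b_j > 0`, `a_j² − b_j² = K²Λ²`, and
`L_x = Y₁ cos w_e cos w_K + Y₂ sin w_e sin w_K`. -/
theorem Lx_in_electric_action_angle_variables
    (Λ Je K : ℝ) (hΛ : 0 < Λ) (hK : K ≠ 0) (hJK : |Je| + |K| < Λ)
    (a1 b1 a2 b2 : ℝ)
    (ha1 : a1 = Λ * (Λ - Je))
    (hb1 : b1 = Λ * Real.sqrt ((Λ - Je) ^ 2 - K ^ 2))
    (ha2 : a2 = Λ * (Λ + Je))
    (hb2 : b2 = Λ * Real.sqrt ((Λ + Je) ^ 2 - K ^ 2))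
    (ρ1 ρ2 : ℝ → ℝ)
    (hρ1 : ∀ θ : ℝ, ρ1 θ = (K * Λ / 2) * ∫ t in (0:ℝ)..θ, 1 / (a1 - b1 * Real.cos t))
    (hρ2 : ∀ θ : ℝ, ρ2 θ = (K * Λ / 2) * ∫ t in (0:ℝ)..θ, 1 / (a2 - b2 * Real.cos t))
    (ψ χ wK : ℝ)
    (ξ η Pξ Pη φ we Y1 Y2 : ℝ)
    (hξ : ξ = Real.sqrt (a1 - b1 * Real.cos ψ))
    (hη : η = Real.sqrt (a2 - b2 * Real.cos χ))
    (hPξ : Pξ = b1 * Real.sin ψ / (Λ * ξ))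
    (hPη : Pη = b2 * Real.sin χ / (Λ * η))
    (hφ : φ = wK + ρ1 ψ + ρ2 χ)
    (hwe : we = (χ - ψ) / 2)
    (hY1 : Y1 = (K / 2) * (Real.sqrt ((a2 - b2) / (a1 - b1))
      - Real.sqrt ((a1 - b1) / (a2 - b2))))
    (hY2 : Y2 = -(|K| / 2) * (Real.sqrt ((a2 + b2) / (a1 - b1))
      - Real.sqrt ((a1 - b1) / (a2 + b2)))) :
    (0 < b1 ∧ b1 < a1 ∧ 0 < b2 ∧ b2 < a2 ∧
      a1 ^ 2 - b1 ^ 2 = K ^ 2 * Λ ^ 2 ∧ a2 ^ 2 - b2 ^ 2 = K ^ 2 * Λ ^ 2) ∧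
    (1 / 2) * (η * Pξ - ξ * Pη) * Real.sin φ
        - (K / (2 * ξ * η)) * (ξ ^ 2 - η ^ 2) * Real.cos φ
      = Y1 * Real.cos we * Real.cos wK + Y2 * Real.sin we * Real.sin wK := by
  have hu1 : |K| < Λ - Je := by linarith [le_abs_self Je]
  have hu2 : |K| < Λ + Je := by linarith [neg_abs_le Je]
  obtain ⟨hb1p, hab1, hsq1⟩ := pos_lt_and_sq_sub_sq_of_abs_lt hΛ hK hu1
  obtain ⟨hb2p, hab2, hsq2⟩ := pos_lt_and_sq_sub_sq_of_abs_lt hΛ hK hu2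
  rw [← hb1] at hb1p
  rw [← hb1, ← ha1] at hab1 hsq1
  rw [← hb2] at hb2p
  rw [← hb2, ← ha2] at hab2 hsq2
  refine ⟨⟨hb1p, hab1, hb2p, hab2, hsq1, hsq2⟩, ?_⟩
  clear ha1 hb1 ha2 hb2
  have hD1 := sub_mul_cos_pos hb1p hab1
  have hD2 := sub_mul_cos_pos hb2p hab2
  obtain ⟨α, hα, hα2⟩ : ∃ α : ℝ, 0 < α ∧ α ^ 2 = a1 - b1 :=
    ⟨√(a1 - b1), sqrt_pos.2 (by linarith), sq_sqrt (by linarith)⟩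
  obtain ⟨γ, hγ, hγ2⟩ : ∃ γ : ℝ, 0 < γ ∧ γ ^ 2 = a2 - b2 :=
    ⟨√(a2 - b2), sqrt_pos.2 (by linarith), sq_sqrt (by linarith)⟩
  obtain ⟨t, ht⟩ : ∃ t : ℝ, K * Λ = α * γ * t := ⟨K * Λ / (α * γ), by field_simp⟩
  have ht0 : t ≠ 0 := by
    rintro rfl
    exact mul_ne_zero hK hΛ.ne' (by rw [ht, mul_zero])
  have hKt : K = α * γ * t / Λ := by rw [← ht]; field_simp
  have hβ2 : (t * γ) ^ 2 = a1 + b1 := by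
    have h : α ^ 2 * (t * γ) ^ 2 = α ^ 2 * (a1 + b1) := by
      linear_combination (a1 + b1) * (-hα2) + hsq1 * (-1) - (K * Λ + α * γ * t) * ht
    exact mul_left_cancel₀ (by positivity) h
  have hδ2 : (t * α) ^ 2 = a2 + b2 := by
    have h : γ ^ 2 * (t * α) ^ 2 = γ ^ 2 * (a2 + b2) := by
      linear_combination (a2 + b2) * (-hγ2) + hsq2 * (-1) - (K * Λ + α * γ * t) * ht
    exact mul_left_cancel₀ (by positivity) h
  obtain ⟨hc1, hs1⟩ := sqrt_mul_cos_and_sin_integral_inv_sub_cos hα hα2 hβ2 hD1 ψ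
  obtain ⟨hc2, hs2⟩ := sqrt_mul_cos_and_sin_integral_inv_sub_cos hγ hγ2 hδ2 hD2 χ
  rw [show α * (t * γ) / 2 = K * Λ / 2 by rw [ht]; ring, ← hρ1, ← hξ] at hc1 hs1
  rw [show γ * (t * α) / 2 = K * Λ / 2 by rw [ht]; ring, ← hρ2, ← hη] at hc2 hs2
  have hξ0 : 0 < ξ := hξ ▸ sqrt_pos.2 (hD1 ψ)
  have hη0 : 0 < η := hη ▸ sqrt_pos.2 (hD2 χ)
  have hp1 := sin_sq_add_cos_sq (ψ / 2)
  have hp2 := sin_sq_add_cos_sq (χ / 2)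
  have hX : ξ ^ 2 = α ^ 2 * cos (ψ / 2) ^ 2 + (t * γ) ^ 2 * sin (ψ / 2) ^ 2 := by
    linear_combination (-ξ ^ 2) * sin_sq_add_cos_sq (ρ1 ψ)
      + (ξ * cos (ρ1 ψ) + α * cos (ψ / 2)) * hc1 + (ξ * sin (ρ1 ψ) + t * γ * sin (ψ / 2)) * hs1
  have hE : η ^ 2 = γ ^ 2 * cos (χ / 2) ^ 2 + (t * α) ^ 2 * sin (χ / 2) ^ 2 := by
    linear_combination (-η ^ 2) * sin_sq_add_cos_sq (ρ2 χ)
      + (η * cos (ρ2 χ) + γ * cos (χ / 2)) * hc2 + (η * sin (ρ2 χ) + t * α * sin (χ / 2)) * hs2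
  obtain ⟨hcos, hsin⟩ := lx_polar_polynomial_identities hp1 hp2 rfl rfl hX hE
    (C := ξ * η * cos (ρ1 ψ + ρ2 χ)) (S := ξ * η * sin (ρ1 ψ + ρ2 χ))
    (by rw [cos_add, ← hc1, ← hc2, ← hs1, ← hs2]; ring)
    (by rw [sin_add, ← hc1, ← hc2, ← hs1, ← hs2]; ring)
  have hb1s : b1 * sin ψ = ((t * γ) ^ 2 - α ^ 2) * sin (ψ / 2) * cos (ψ / 2) := by
    rw [show sin ψ = 2 * sin (ψ / 2) * cos (ψ / 2) by rw [← sin_two_mul]; ring_nf, hα2, hβ2]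
    ring
  have hb2s : b2 * sin χ = ((t * α) ^ 2 - γ ^ 2) * sin (χ / 2) * cos (χ / 2) := by
    rw [show sin χ = 2 * sin (χ / 2) * cos (χ / 2) by rw [← sin_two_mul]; ring_nf, hγ2, hδ2]
    ring
  have hY1' : Y1 = t * (γ ^ 2 - α ^ 2) / (2 * Λ) := by
    rw [hY1, ← hα2, ← hγ2, ← div_pow, ← div_pow, sqrt_sq (by positivity), sqrt_sq (by positivity),
      hKt]
    field_simp
  have hY2' : Y2 = α * γ * (1 - t ^ 2) / (2 * Λ) := by
    have habs : |K| = α * γ * |t| / Λ := by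
      rw [hKt, abs_div, abs_mul, abs_of_pos hΛ, abs_of_pos (mul_pos hα hγ)]
    rw [hY2, ← hα2, ← hδ2, ← div_pow, ← div_pow, sqrt_sq_eq_abs, sqrt_sq_eq_abs, abs_div, abs_div,
      abs_mul, abs_of_pos hα, habs, ← sq_abs t]
    have := abs_pos.2 ht0
    field_simp
    ring
  rw [hPξ, hPη, hb1s, hb2s, hY1', hY2', hφ, hwe, sub_div, cos_sub, sin_sub, add_assoc,
    sin_add wK, cos_add wK, hKt]
  field_simp
  apply mul_left_cancel₀ (mul_pos hξ0 hη0).ne'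
  linear_combination cos wK * hcos + sin wK * hsin
end
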